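/- Let T be a tournament on a set V of n players, where n is a power of two, and let K be a king of T. Put A = N_out(K) and B = N_in(K). Suppose B is a disjoint union of three (possibly empty) sets H, I, J such that (1) |H| < |A|; (2) every player i ∈ I is beaten by at least log₂ n players of A; and (3) every player j ∈ J satisfies out(j) ≤ |A|. Then K is an SE winner of T. -/

import Mathlib

/-- A tournament relation on `V`: irreflexive, asymmetric, and total. -/
structure IsTournament {V : Type*} (beats : V → V → Prop) : Prop where
  irrefl : ∀ v, ¬ beats v v
  asymm : ∀ u v, beats u v → ¬ beats v u
  total : ∀ u v, u ≠ v → beats u v ∨ beats v u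

/-- `SEWinner beats S v` : the player `v` can win a balanced single-elimination
tournament among the players of `S` under some seeding.  Either `S = {v}`, or `S`
can be partitioned into pairs (via a fixed-point-free involution `f` of `S`) such
that `v` is an SE winner of the set `W` of winners of the pairs. -/
inductive SEWinner {V : Type*} (beats : V → V → Prop) : Finset V → V → Prop
  | single (v : V) : SEWinner beats {v} v
  | round (S W : Finset V) (f : V → V) (v : V)
      (hf : ∀ x ∈ S, f x ∈ S ∧ f x ≠ x ∧ f (f x) = x)
      (hW : ∀ x, x ∈ W ↔ x ∈ S ∧ beats x (f x))
      (hw : SEWinner beats W v) : SEWinner beats S v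

/-- A king: every other player is beaten by `v` or by someone `v` beats. -/
def IsKing {V : Type*} (beats : V → V → Prop) (v : V) : Prop :=
  ∀ u, u ≠ v → beats v u ∨ ∃ w, beats v w ∧ beats w u

/-- A 3-king: every other player is reachable from `v` in at most 3 steps. -/
def IsThreeKing {V : Type*} (beats : V → V → Prop) (v : V) : Prop :=
  ∀ u, u ≠ v → beats v u ∨ (∃ w, beats v w ∧ beats w u) ∨
    ∃ w x, beats v w ∧ beats w x ∧ beats x u

/-- The out-degree of a player. -/
noncomputable def outDeg {V : Type*} [Fintype V] (beats : V → V → Prop) (v : V) : ℕ :=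
  {u | beats v u}.ncard

/-- The number of directed `k`-paths originating at `v`. -/
noncomputable def kPathCount {V : Type*} [Fintype V] (beats : V → V → Prop) (k : ℕ) (v : V) : ℕ :=
  {p : Fin (k + 1) → V | Function.Injective p ∧ p 0 = v ∧
    ∀ i : Fin k, beats (p i.castSucc) (p i.succ)}.ncard

/-- A superking: a king `v` such that every player beating `v` is beaten by at
least `log₂ n` players whom `v` beats. -/
def IsSuperking {V : Type*} [Fintype V] (beats : V → V → Prop) (v : V) : Prop :=
  IsKing beats v ∧ ∀ u, beats u v →
    Real.logb 2 (Fintype.card V) ≤ ({w | beats v w ∧ beats w u}.ncard : ℝ)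

/-- One round on `S` with set of winners `W`. -/
def RoundTo {V : Type*} (beats : V → V → Prop) (S W : Finset V) : Prop :=
  ∃ f : V → V, (∀ x ∈ S, f x ∈ S ∧ f x ≠ x ∧ f (f x) = x) ∧
    (∀ x, x ∈ W ↔ x ∈ S ∧ beats x (f x))

section helpers
open Classical

variable {V : Type*} {beats : V → V → Prop}

theorem RoundTo.empty : RoundTo beats ∅ ∅ := ⟨id, by simp, by simp⟩

theorem RoundTo.sub {S W : Finset V} (h : RoundTo beats S W) : W ⊆ S := by
  obtain ⟨f, hf, hW⟩ := h
  intro x hx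
  exact ((hW x).1 hx).1

theorem RoundTo.loser (hT : IsTournament beats) {S W : Finset V} (h : RoundTo beats S W)
    {w : V} (hw : w ∈ W) : ∃ x ∈ S, x ∉ W ∧ beats w x := by
  obtain ⟨f, hf, hW⟩ := h
  obtain ⟨h1, h2⟩ := (hW w).1 hw
  obtain ⟨h3, h4, h5⟩ := hf w h1
  refine ⟨f w, h3, ?_, h2⟩
  intro h6
  have := ((hW _).1 h6).2
  rw [h5] at this
  exact hT.asymm _ _ h2 this

theorem RoundTo.union {S W S' W' : Finset V} (h : RoundTo beats S W) (h' : RoundTo beats S' W')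
    (hd : Disjoint S S') : RoundTo beats (S ∪ S') (W ∪ W') := by
  have s1 := h.sub
  have s2 := h'.sub
  obtain ⟨f, hf, hW⟩ := h
  obtain ⟨g, hg, hW'⟩ := h'
  rw [Finset.disjoint_left] at hd
  refine ⟨fun x => if x ∈ S then f x else g x, ?_, ?_⟩
  · intro x hx
    by_cases hxS : x ∈ S
    · have := hf x hxS
      simp only [hxS, if_true, this.1, Finset.mem_union]
      exact ⟨Or.inl trivial, this.2.1, this.2.2⟩
    · have hx' : x ∈ S' := by
        rcases Finset.mem_union.1 hx with h | h
        · exact absurd h hxS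
        · exact h
      have := hg x hx'
      have hn : g x ∉ S := fun h => hd h this.1
      simp only [hxS, if_false, hn, Finset.mem_union]
      exact ⟨Or.inr this.1, this.2.1, this.2.2⟩
  · intro x
    by_cases hxS : x ∈ S
    · have h1 : x ∉ S' := hd hxS
      have h2 : x ∉ W' := fun h => h1 (s2 h)
      simp [hxS, h2, hW]
    · have h2 : x ∉ W := fun h => hxS (s1 h)
      simp [hxS, h2, hW']

theorem RoundTo.pair (hT : IsTournament beats) {a b : V} (h : beats a b) :
    RoundTo beats {a, b} {a} := by
  have hab : a ≠ b := by
    rintro rfl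
    exact hT.irrefl _ h
  have hba := hT.asymm _ _ h
  refine ⟨fun x => if x = a then b else a, ?_, ?_⟩
  · intro x hx
    simp only [Finset.mem_insert, Finset.mem_singleton] at hx ⊢
    rcases hx with rfl | rfl
    · simp [hab.symm]
    · simp [hab.symm, hab]
  · intro x
    simp only [Finset.mem_insert, Finset.mem_singleton]
    by_cases hx : x = a
    · simp [hx, h]
    · simp only [hx, if_false, false_or, false_iff, not_and]
      rintro rfl
      exact hba

theorem RoundTo.exists_even (hT : IsTournament beats) : ∀ (n : ℕ) (S : Finset V), S.card = 2 * n →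
    ∃ W, RoundTo beats S W ∧ W.card = n := by
  intro n
  induction n with
  | zero =>
    intro S hS
    have : S = ∅ := by simpa using hS
    subst this
    exact ⟨∅, RoundTo.empty, rfl⟩
  | succ n ih =>
    intro S hS
    obtain ⟨a, ha⟩ : S.Nonempty := Finset.card_pos.1 (by omega)
    have h1 := Finset.card_erase_of_mem ha
    obtain ⟨b, hb⟩ : (S.erase a).Nonempty := Finset.card_pos.1 (by omega)
    have h2 := Finset.card_erase_of_mem hb
    obtain ⟨W, hW, hWc⟩ := ih ((S.erase a).erase b) (by omega)
    have hba : b ≠ a := Finset.ne_of_mem_erase hb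
    have hbS := Finset.mem_of_mem_erase hb
    have haW : a ∉ W := fun h => by simpa using hW.sub h
    have hbW : b ∉ W := fun h => by simpa using hW.sub h
    have key : ∃ w, (w = a ∨ w = b) ∧ RoundTo beats {a, b} {w} := by
      rcases hT.total a b hba.symm with h | h
      · exact ⟨a, Or.inl rfl, RoundTo.pair hT h⟩
      · refine ⟨b, Or.inr rfl, ?_⟩
        rw [Finset.pair_comm]
        exact RoundTo.pair hT h
    obtain ⟨w, hw, hR⟩ := key
    have := hR.union hW (by
      rw [Finset.disjoint_left]
      intro x hx
      simp only [Finset.mem_insert, Finset.mem_singleton] at hx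
      rcases hx with rfl | rfl <;> simp)
    refine ⟨{w} ∪ W, ?_, ?_⟩
    · convert this using 1
      ext x
      simp only [Finset.mem_union, Finset.mem_insert, Finset.mem_singleton, Finset.mem_erase]
      grind
    · have hwW : w ∉ W := by rcases hw with rfl | rfl <;> assumption
      rw [Finset.card_union_of_disjoint (by simpa using hwW)]
      simp
      omega

/-- Pairing three groups with few crossing pairs. -/
theorem RoundTo.exists_three (hT : IsTournament beats) (P Q R : Finset V) (hPQ : Disjoint P Q)
    (hPR : Disjoint P R) (hQR : Disjoint Q R) (n : ℕ) (hn : P.card + Q.card + R.card = 2 * n) :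
    ∃ W, RoundTo beats (P ∪ Q ∪ R) W ∧ W.card = n ∧ P.card / 2 ≤ (P ∩ W).card ∧
      (R ∩ W).card ≤ (R.card + 1) / 2 := by
  obtain ⟨P0, hP0, hP0c⟩ := Finset.exists_subset_card_eq (s := P) (n := 2 * (P.card / 2)) (by omega)
  obtain ⟨R0, hR0, hR0c⟩ := Finset.exists_subset_card_eq (s := R) (n := 2 * (R.card / 2)) (by omega)
  obtain ⟨WP, hWP, hWPc⟩ := RoundTo.exists_even hT _ P0 hP0c
  obtain ⟨WR, hWR, hWRc⟩ := RoundTo.exists_even hT _ R0 hR0c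
  have hd0 : Disjoint P0 R0 := Finset.disjoint_of_subset_left hP0
    (Finset.disjoint_of_subset_right hR0 hPR)
  have hd1 : Disjoint P (Q ∪ R) := by
    rw [Finset.disjoint_union_right]; exact ⟨hPQ, hPR⟩
  have hsub : P0 ∪ R0 ⊆ P ∪ Q ∪ R := by
    intro x hx
    rcases Finset.mem_union.1 hx with h | h
    · simp [hP0 h]
    · simp [hR0 h]
  have hcS : (P ∪ Q ∪ R).card = 2 * n := by
    rw [Finset.union_assoc, Finset.card_union_of_disjoint hd1, Finset.card_union_of_disjoint hQR]
    omega
  have hc0 : (P0 ∪ R0).card = 2 * (P.card / 2) + 2 * (R.card / 2) := by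
    rw [Finset.card_union_of_disjoint hd0]; omega
  have hc1 := Finset.card_sdiff_of_subset hsub
  obtain ⟨W1, hW1, hW1c⟩ := RoundTo.exists_even hT (n - P.card / 2 - R.card / 2)
    ((P ∪ Q ∪ R) \ (P0 ∪ R0)) (by omega)
  have hR1 := (hWP.union hWR hd0).union hW1 Finset.disjoint_sdiff
  refine ⟨WP ∪ WR ∪ W1, ?_, ?_, ?_, ?_⟩
  · convert hR1 using 1
    rw [Finset.union_sdiff_of_subset hsub]
  · have hdd : Disjoint WP WR := Finset.disjoint_of_subset_left hWP.sub
      (Finset.disjoint_of_subset_right hWR.sub hd0)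
    have hdd' : Disjoint (WP ∪ WR) W1 := Finset.disjoint_of_subset_left (hWP.union hWR hd0).sub
      (Finset.disjoint_of_subset_right hW1.sub Finset.disjoint_sdiff)
    rw [Finset.card_union_of_disjoint hdd', Finset.card_union_of_disjoint hdd]
    omega
  · rw [← hWPc]
    apply Finset.card_le_card
    intro x hx
    simp [hx, hP0 (hWP.sub hx)]
  · have : R ∩ (WP ∪ WR ∪ W1) ⊆ WR ∪ (R \ R0) := by
      intro x hx
      simp only [Finset.mem_inter, Finset.mem_union, Finset.mem_sdiff] at hx ⊢
      obtain ⟨hxR, (h | h) | h⟩ := hx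
      · exact absurd hxR (Finset.disjoint_left.1 hPR (hP0 (hWP.sub h)))
      · exact Or.inl h
      · have := hW1.sub h
        simp only [Finset.mem_sdiff, Finset.mem_union] at this
        tauto
    have h1 := Finset.card_le_card this
    have h2 := Finset.card_union_le WR (R \ R0)
    have h3 := Finset.card_sdiff_of_subset hR0
    omega

/-- Matchings `A → B` in which the `A`-players win. -/
inductive Mtch (beats : V → V → Prop) : Finset V → Finset V → Prop
  | nil : Mtch beats ∅ ∅
  | cons (a b : V) (A B : Finset V) (ha : a ∉ A) (hb : b ∉ B) (hab : beats a b)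
      (h : Mtch beats A B) : Mtch beats (insert a A) (insert b B)

theorem Mtch.card {A B : Finset V} (h : Mtch beats A B) : A.card = B.card := by
  induction h with
  | nil => rfl
  | cons a b A B ha hb hab h ih => simp [ha, hb, ih]

theorem Mtch.round (hT : IsTournament beats) {A B : Finset V} (h : Mtch beats A B)
    (hd : Disjoint A B) : RoundTo beats (A ∪ B) A := by
  induction h with
  | nil => simpa using RoundTo.empty
  | cons a b A B ha hb hab h ih =>
    rw [Finset.disjoint_left] at hd
    have hd' : Disjoint A B := by
      rw [Finset.disjoint_left]
      intro x hx hx'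
      exact hd (Finset.mem_insert_of_mem hx) (Finset.mem_insert_of_mem hx')
    have h1 := (RoundTo.pair hT hab).union (ih hd') (by
      rw [Finset.disjoint_left]
      intro x hx
      simp only [Finset.mem_insert, Finset.mem_singleton, Finset.mem_union] at hx hd ⊢
      grind)
    convert h1 using 1
    · ext x
      simp only [Finset.mem_insert, Finset.mem_singleton, Finset.mem_union]
      tauto
    · ext x
      simp only [Finset.mem_insert, Finset.mem_singleton, Finset.mem_union]

theorem Mtch.exists_max : ∀ (n : ℕ) (A X : Finset V), A.card = n →
    ∃ A1 X1, A1 ⊆ A ∧ X1 ⊆ X ∧ Mtch beats A1 X1 ∧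
      ∀ a ∈ A, a ∉ A1 → ∀ x ∈ X, x ∉ X1 → ¬ beats a x := by
  intro n
  induction n with
  | zero =>
    intro A X hA
    have : A = ∅ := by simpa using hA
    subst this
    exact ⟨∅, ∅, by simp, by simp, Mtch.nil, by simp⟩
  | succ n ih =>
    intro A X hA
    by_cases h : ∃ a ∈ A, ∃ x ∈ X, beats a x
    · obtain ⟨a, ha, x, hx, hax⟩ := h
      obtain ⟨A1, X1, hA1, hX1, hM, hmax⟩ := ih (A.erase a) (X.erase x) (by
        rw [Finset.card_erase_of_mem ha]; omega)
      refine ⟨insert a A1, insert x X1, ?_, ?_, ?_, ?_⟩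
      · intro y hy
        rcases Finset.mem_insert.1 hy with rfl | hy
        · exact ha
        · exact Finset.mem_of_mem_erase (hA1 hy)
      · intro y hy
        rcases Finset.mem_insert.1 hy with rfl | hy
        · exact hx
        · exact Finset.mem_of_mem_erase (hX1 hy)
      · exact Mtch.cons a x A1 X1 (fun h => by simpa using hA1 h) (fun h => by simpa using hX1 h)
          hax hM
      · intro a' ha' hn x' hx' hn'
        simp only [Finset.mem_insert, not_or] at hn hn'
        exact hmax a' (Finset.mem_erase.2 ⟨hn.1, ha'⟩) hn.2 x' (Finset.mem_erase.2 ⟨hn'.1, hx'⟩) hn'.2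
    · push Not at h
      exact ⟨∅, ∅, by simp, by simp, Mtch.nil, fun a ha _ x hx _ => h a ha x hx⟩

/-- A player of out-degree at most `|A|` beaten by at most one player of `A` beats no-one else. -/
theorem weak_player (hT : IsTournament beats) {S A : Finset V} {K j a y : V} (hKS : K ∈ S)
    (hAS : A ⊆ S) (hKA : K ∉ A) (hjA : j ∉ A) (hjK : beats j K)
    (hin : ∀ c ∈ A, beats c j → c = a)
    (hout : (S.filter (beats j)).card ≤ A.card) (hyS : y ∈ S) (hyA : y ∉ A) (hyK : y ≠ K) :
    ¬ beats j y := by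
  intro hb
  have hsub : insert y (insert K (A.erase a)) ⊆ S.filter (beats j) := by
    intro x hx
    simp only [Finset.mem_insert, Finset.mem_erase, Finset.mem_filter] at hx ⊢
    rcases hx with rfl | rfl | ⟨h1, h2⟩
    · exact ⟨hyS, hb⟩
    · exact ⟨hKS, hjK⟩
    · refine ⟨hAS h2, ?_⟩
      have hne : j ≠ x := by
        rintro rfl
        exact hjA h2
      rcases hT.total j x hne with h | h
      · exact h
      · exact absurd (hin x h2 h) h1
  have h1 := Finset.card_le_card hsub
  rw [Finset.card_insert_of_notMem (by simp [hyK, hyA]),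
    Finset.card_insert_of_notMem (by simp [hKA])] at h1
  have h2 := Finset.pred_card_le_card_erase (s := A) (a := a)
  omega

set_option maxHeartbeats 4000000 in
theorem king_main (hT : IsTournament beats) (K : V) : ∀ (k : ℕ) (S A H X : Finset V),
    S.card = 2 ^ (k + 1) →
    S = insert K (A ∪ H ∪ X) → Disjoint A H → Disjoint A X → Disjoint H X →
    (∀ a ∈ A, beats K a) → (∀ h ∈ H, beats h K) → (∀ x ∈ X, beats x K) →
    (∀ h ∈ H, ∃ a ∈ A, beats a h) → (∀ x ∈ X, ∃ a ∈ A, beats a x) →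
    H.card < A.card →
    (∀ x ∈ X, k + 1 ≤ (A.filter (fun a => beats a x)).card ∨
      (S.filter (beats x)).card ≤ A.card) →
    SEWinner beats S K := by
  intro k
  induction k with
  | zero =>
    intro S A H X hSc hS hAH hAX hHX hA hH hX _ _ hc _
    obtain ⟨a, ha⟩ : A.Nonempty := Finset.card_pos.1 (by omega)
    have haK : K ≠ a := by
      rintro rfl
      exact hT.irrefl _ (hA _ ha)
    have hSe : ({K, a} : Finset V) = S := by
      apply Finset.eq_of_subset_of_card_le
      · intro x hx
        simp only [Finset.mem_insert, Finset.mem_singleton] at hx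
        rcases hx with rfl | rfl <;> simp [hS, ha]
      · rw [Finset.card_pair haK, hSc]; norm_num
    obtain ⟨f, hf, hW⟩ := RoundTo.pair hT (hA a ha)
    rw [hSe] at hf hW
    exact SEWinner.round S {K} f K hf hW (SEWinner.single K)
  | succ k ih =>
    intro S A H X hSc hS hAH hAX hHX hA hH hX hkH hkX hc hI
    have hKA : K ∉ A := fun h => hT.irrefl _ (hA _ h)
    have hKH : K ∉ H := fun h => hT.irrefl _ (hH _ h)
    have hKX : K ∉ X := fun h => hT.irrefl _ (hX _ h)
    have hpow : 2 ^ (k + 1 + 1) = 2 * 2 ^ (k + 1) := by ring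
    have hpow' : 2 ^ (k + 1) = 2 * 2 ^ k := by ring
    have hpos : 0 < 2 ^ k := by positivity
    have hScard : S.card = 1 + A.card + H.card + X.card := by
      rw [hS, Finset.card_insert_of_notMem (by simp [hKA, hKH, hKX]),
        Finset.card_union_of_disjoint (by rw [Finset.disjoint_union_left]; exact ⟨hAX, hHX⟩),
        Finset.card_union_of_disjoint hAH]
      omega
    have hAS : A ⊆ S := by intro x hx; simp [hS, hx]
    have hHS : H ⊆ S := by intro x hx; simp [hS, hx]
    have hXS : X ⊆ S := by intro x hx; simp [hS, hx]
    have hKS : K ∈ S := by simp [hS]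
    have dAH := Finset.disjoint_left.1 hAH
    have dAX := Finset.disjoint_left.1 hAX
    have dHX := Finset.disjoint_left.1 hHX
    have weak : ∀ j ∈ X, ∀ a, (∀ c ∈ A, beats c j → c = a) → ∀ y, (y ∈ H ∨ y ∈ X) →
        ¬ beats j y := by
      intro j hj a hin y hy
      have hyS : y ∈ S := by rcases hy with h | h <;> [exact hHS h; exact hXS h]
      have hyA : y ∉ A := fun h => by rcases hy with h' | h' <;> [exact dAH h h'; exact dAX h h']
      have hyK : y ≠ K := by rintro rfl; tauto
      refine weak_player hT hKS hAS hKA (fun h => dAX h hj) (hX j hj) hin ?_ hyS hyA hyK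
      rcases hI j hj with h | h
      · exfalso
        have : A.filter (fun a => beats a j) ⊆ {a} := by
          intro c hc'
          simp only [Finset.mem_filter] at hc'
          simpa using hin c hc'.1 hc'.2
        have := Finset.card_le_card this
        simp at this
        omega
      · exact h
    have weak1 : ∀ a, (∀ j ∈ X, ∀ c ∈ A, beats c j → c = a) → X.card ≤ 1 := by
      intro a h
      rw [Finset.card_le_one]
      intro x hx y hy
      by_contra hne
      rcases hT.total x y hne with h' | h'
      · exact weak x hx a (h x hx) y (Or.inr hy) h'
      · exact weak y hy a (h y hy) x (Or.inr hx) h'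
    obtain ⟨A1, H1, hA1, hH1, hM1, hmax1⟩ := Mtch.exists_max (beats := beats) _ A H rfl
    obtain ⟨A2, X2, hA2, hX2, hM2, hmax2⟩ := Mtch.exists_max (beats := beats) _ (A \ A1) X rfl
    have hc1 := hM1.card
    have hc2 := hM2.card
    have hA2' : A2 ⊆ A := fun x hx => (Finset.mem_sdiff.1 (hA2 hx)).1
    have hd12 : Disjoint A1 A2 := by
      rw [Finset.disjoint_left]
      intro x hx hx'
      exact (Finset.mem_sdiff.1 (hA2 hx')).2 hx
    have hH1c := Finset.card_le_card hH1
    have hX2c := Finset.card_le_card hX2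
    have h12sub : A1 ∪ A2 ⊆ A := Finset.union_subset hA1 hA2'
    have h12c : (A1 ∪ A2).card = A1.card + A2.card := Finset.card_union_of_disjoint hd12
    have h12le := Finset.card_le_card h12sub
    -- some player of `H` is matched
    have hHpos : 0 < H.card → 0 < A1.card := by
      intro h
      obtain ⟨h0, hh0⟩ := Finset.card_pos.1 h
      obtain ⟨a, ha, hab⟩ := hkH h0 hh0
      by_contra hcon
      have e1 : A1 = ∅ := Finset.card_eq_zero.1 (by omega)
      have e2 : H1 = ∅ := Finset.card_eq_zero.1 (by omega)
      exact hmax1 a ha (by simp [e1]) h0 hh0 (by simp [e2]) hab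
    have hRc := Finset.card_sdiff_of_subset hH1
    by_cases hL : ∃ a0 ∈ A, a0 ∉ A1 ∪ A2
    · obtain ⟨a0, ha0, ha0n⟩ := hL
      have hPsub : insert a0 (A1 ∪ A2) ⊆ A := Finset.insert_subset ha0 h12sub
      have hPc := Finset.card_sdiff_of_subset hPsub
      have hPle := Finset.card_le_card hPsub
      rw [Finset.card_insert_of_notMem ha0n] at hPc hPle
      have hQc := Finset.card_sdiff_of_subset hX2
      obtain ⟨W0, hW0, hW0c, hPW, hRW⟩ := RoundTo.exists_three hT (A \ insert a0 (A1 ∪ A2)) (X \ X2)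
        (H \ H1)
        (Finset.disjoint_of_subset_left Finset.sdiff_subset
          (Finset.disjoint_of_subset_right Finset.sdiff_subset hAX))
        (Finset.disjoint_of_subset_left Finset.sdiff_subset
          (Finset.disjoint_of_subset_right Finset.sdiff_subset hAH))
        (Finset.disjoint_of_subset_left Finset.sdiff_subset
          (Finset.disjoint_of_subset_right Finset.sdiff_subset hHX.symm))
        (2 ^ (k + 1) - 1 - A1.card - A2.card) (by omega)
      generalize hPe : A \ insert a0 (A1 ∪ A2) = P at *
      have hPm : ∀ x, x ∈ P ↔ x ∈ A ∧ x ≠ a0 ∧ x ∉ A1 ∧ x ∉ A2 := by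
        intro x; rw [← hPe]; simp
      have hR1 := RoundTo.pair hT (hA a0 ha0)
      have hRA1 := hM1.round hT (Finset.disjoint_of_subset_left hA1
          (Finset.disjoint_of_subset_right hH1 hAH))
      have hRA2 := hM2.round hT (Finset.disjoint_of_subset_left hA2'
          (Finset.disjoint_of_subset_right hX2 hAX))
      have hsubW := hW0.sub
      simp only [Finset.mem_union, not_or] at ha0n
      have hRound : RoundTo beats S (insert K (A1 ∪ A2 ∪ W0)) := by
        have := ((hR1.union hRA1 ?_).union hRA2 ?_).union hW0 ?_
        · convert this using 1
          · rw [hS]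
            ext x
            have e1 := @hA1 x
            have e2 := @hA2' x
            have e3 := @hH1 x
            have e4 := @hX2 x
            simp only [Finset.mem_insert, Finset.mem_union, Finset.mem_singleton,
              Finset.mem_sdiff, hPm]
            grind
          · ext x
            simp only [Finset.mem_insert, Finset.mem_union, Finset.mem_singleton]
            clear * -
            tauto
        all_goals
          rw [Finset.disjoint_left]
          intro x
          have e1 := @hA1 x
          have e2 := @hA2' x
          have e3 := @hH1 x
          have e4 := @hX2 x
          have e5 := @dAH x
          have e6 := @dAX x
          have e7 := @dHX x
          have e8 := fun h => (Finset.disjoint_left.1 hd12) (show x ∈ A1 from h)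
          simp only [Finset.mem_insert, Finset.mem_union, Finset.mem_singleton,
              Finset.mem_sdiff, hPm]
          grind
      have hA'c : (A1 ∪ A2 ∪ (P ∩ W0)).card = A1.card + A2.card + (P ∩ W0).card := by
        rw [Finset.card_union_of_disjoint, h12c]
        rw [Finset.disjoint_left]
        intro x
        simp only [Finset.mem_union, Finset.mem_inter, hPm]
        clear * -
        tauto
      have hA'sub : A1 ∪ A2 ∪ (P ∩ W0) ⊆ A := by
        refine Finset.union_subset h12sub ?_
        intro x hx
        exact ((hPm x).1 (Finset.mem_inter.1 hx).1).1
      -- membership facts for unmatched players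
      have inH : ∀ h ∈ H \ H1, ∀ a ∈ A, beats a h → a ∈ A1 := by
        intro h hh a ha hab
        rw [Finset.mem_sdiff] at hh
        by_contra hn
        exact hmax1 a ha hn h hh.1 hh.2 hab
      have inX : ∀ x ∈ X \ X2, ∀ a ∈ A, beats a x → a ∈ A1 ∪ A2 := by
        intro x hx a ha hab
        rw [Finset.mem_sdiff] at hx
        by_contra hn
        simp only [Finset.mem_union, not_or] at hn
        exact hmax2 a (Finset.mem_sdiff.2 ⟨ha, hn.1⟩) hn.2 x hx.1 hx.2 hab
      have hWeq : insert K (A1 ∪ A2 ∪ W0) =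
          insert K ((A1 ∪ A2 ∪ (P ∩ W0)) ∪ ((H \ H1) ∩ W0) ∪ ((X \ X2) ∩ W0)) := by
        ext x
        have := @hsubW x
        simp only [Finset.mem_insert, Finset.mem_union, Finset.mem_inter] at this ⊢
        clear * - this
        tauto
      have hWS := hRound.sub
      have hWcard : (insert K (A1 ∪ A2 ∪ W0)).card = 2 ^ (k + 1) := by
        rw [Finset.card_insert_of_notMem, Finset.card_union_of_disjoint, h12c, hW0c]
        · omega
        · rw [Finset.disjoint_left]
          intro x hx hx'
          have := hsubW hx'
          have e0 := h12sub hx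
          have e5 := @dAH x
          have e6 := @dAX x
          simp only [Finset.mem_union, Finset.mem_sdiff, hPm] at this hx
          clear * - this hx e0 e5 e6
          tauto
        · intro hK
          simp only [Finset.mem_union] at hK
          rcases hK with (h | h) | h
          · exact hKA (hA1 h)
          · exact hKA (hA2' h)
          · have := hsubW h
            simp only [Finset.mem_union, Finset.mem_sdiff, hPm] at this
            clear * - this hKA hKH hKX
            tauto
      obtain ⟨f, hf, hWf⟩ := hRound
      refine SEWinner.round S _ f K hf hWf ?_
      refine ih _ (A1 ∪ A2 ∪ (P ∩ W0)) ((H \ H1) ∩ W0) ((X \ X2) ∩ W0) hWcard hWeq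
        ?_ ?_ ?_ ?_ ?_ ?_ ?_ ?_ ?_ ?_
      · refine Finset.disjoint_of_subset_left hA'sub (Finset.disjoint_of_subset_right ?_ hAH)
        exact Finset.inter_subset_left.trans Finset.sdiff_subset
      · refine Finset.disjoint_of_subset_left hA'sub (Finset.disjoint_of_subset_right ?_ hAX)
        exact Finset.inter_subset_left.trans Finset.sdiff_subset
      · refine Finset.disjoint_of_subset_left ?_ (Finset.disjoint_of_subset_right ?_ hHX)
        · exact Finset.inter_subset_left.trans Finset.sdiff_subset
        · exact Finset.inter_subset_left.trans Finset.sdiff_subset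
      · exact fun a ha => hA a (hA'sub ha)
      · exact fun h hh => hH h (Finset.mem_sdiff.1 (Finset.mem_inter.1 hh).1).1
      · exact fun h hh => hX h (Finset.mem_sdiff.1 (Finset.mem_inter.1 hh).1).1
      · intro h hh
        have hh := (Finset.mem_inter.1 hh).1
        obtain ⟨a, ha, hab⟩ := hkH h (Finset.mem_sdiff.1 hh).1
        exact ⟨a, by simp [inH h hh a ha hab], hab⟩
      · intro h hh
        have hh := (Finset.mem_inter.1 hh).1
        obtain ⟨a, ha, hab⟩ := hkX h (Finset.mem_sdiff.1 hh).1
        exact ⟨a, Finset.mem_union_left _ (inX h hh a ha hab), hab⟩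
      · rw [hA'c]
        by_cases hH0 : H.card = 0
        · -- H empty
          by_cases hX0 : X.card = 0
          · omega
          · obtain ⟨x, hx⟩ := Finset.card_pos.1 (Nat.pos_of_ne_zero hX0)
            obtain ⟨a, ha, hab⟩ := hkX x hx
            have : 0 < A1.card + A2.card := by
              by_contra hcon
              have e1 : A1 = ∅ := Finset.card_eq_zero.1 (by omega)
              have e2 : A2 = ∅ := Finset.card_eq_zero.1 (by omega)
              have e3 : X2 = ∅ := Finset.card_eq_zero.1 (by omega)
              have := inX x (by simp [e3, hx]) a ha hab
              simp [e1, e2] at this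
            omega
        · have hp := hHpos (Nat.pos_of_ne_zero hH0)
          by_cases h3 : 3 ≤ A1.card + A2.card + A1.card
          · omega
          · have e1 : A1.card = 1 := by omega
            have e2 : A2.card = 0 := by omega
            have e2' : A2 = ∅ := Finset.card_eq_zero.1 e2
            have e3 : X2 = ∅ := Finset.card_eq_zero.1 (by omega)
            obtain ⟨a, ha⟩ := Finset.card_eq_one.1 e1
            have hX1 := weak1 a (by
              intro j hj c hcA hcj
              have := inX j (by simp [e3, hj]) c hcA hcj
              simpa [ha, e2'] using this)
            omega
      · intro x hx
        have hxQ := (Finset.mem_inter.1 hx).1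
        have hxX := (Finset.mem_sdiff.1 hxQ).1
        rcases hI x hxX with h | h
        · left
          have : A.filter (fun a => beats a x) ⊆
              (A1 ∪ A2 ∪ (P ∩ W0)).filter (fun a => beats a x) := by
            intro a ha
            rw [Finset.mem_filter] at ha ⊢
            exact ⟨Finset.mem_union_left _ (inX x hxQ a ha.1 ha.2), ha.2⟩
          have := Finset.card_le_card this
          omega
        · right
          have hsub : (insert K (A1 ∪ A2 ∪ W0)).filter (beats x) ∪
              (A \ (A1 ∪ A2 ∪ (P ∩ W0))) ⊆ S.filter (beats x) := by
            intro y hy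
            simp only [Finset.mem_union, Finset.mem_filter] at hy ⊢
            rcases hy with hy | hy
            · exact ⟨hWS hy.1, hy.2⟩
            · rw [Finset.mem_sdiff] at hy
              refine ⟨hAS hy.1, ?_⟩
              have hne : x ≠ y := by
                rintro rfl
                exact dAX hy.1 hxX
              rcases hT.total x y hne with h' | h'
              · exact h'
              · exact absurd (Finset.mem_union_left _ (inX x hxQ y hy.1 h')) hy.2
          have h4 := Finset.card_le_card hsub
          rw [Finset.card_union_of_disjoint, Finset.card_sdiff_of_subset hA'sub] at h4
          · have := Finset.card_le_card hA'sub
            omega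
          · rw [Finset.disjoint_left]
            intro y hy hy'
            have hyW := (Finset.mem_filter.1 hy).1
            rw [hWeq] at hyW
            rw [Finset.mem_sdiff] at hy'
            have e5 := @dAH y hy'.1
            have e6 := @dAX y hy'.1
            rw [Finset.mem_insert, Finset.mem_union, Finset.mem_union (s := A1 ∪ A2 ∪ (P ∩ W0)),
              Finset.mem_inter (s₁ := H \ H1), Finset.mem_inter (s₁ := X \ X2),
              Finset.mem_sdiff, Finset.mem_sdiff] at hyW
            rcases hyW with rfl | (h' | h') | h'
            · exact hKA hy'.1
            · exact hy'.2 h'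
            · exact e5 h'.1.1
            · exact e6 h'.1.1
    · push Not at hL
      have hAeq : A1 ∪ A2 = A := Finset.Subset.antisymm h12sub hL
      have hAc : A.card = A1.card + A2.card := by rw [← hAeq, h12c]
      cases hM2 with
      | nil =>
        simp at hAc
        omega
      | cons a b A3 X3 ha hb hab hM3 =>
        have hc3 := hM3.card
        rw [Finset.card_insert_of_notMem ha] at hAc hc2 h12c
        rw [Finset.card_insert_of_notMem hb] at hc2 hX2c
        have haA : a ∈ A := hA2' (by simp)
        have hbX : b ∈ X := hX2 (by simp)
        have ha1 : a ∉ A1 := (Finset.mem_sdiff.1 (hA2 (Finset.mem_insert_self _ _))).2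
        have hA3 : A3 ⊆ A := fun x hx => hA2' (Finset.mem_insert_of_mem hx)
        have hX3 : X3 ⊆ X := fun x hx => hX2 (Finset.mem_insert_of_mem hx)
        have hA13 : A1 ∪ A3 = A.erase a := by
          rw [← hAeq]
          ext x
          simp only [Finset.mem_union, Finset.mem_erase, Finset.mem_insert]
          grind
        have hd13 : Disjoint A1 A3 := Finset.disjoint_of_subset_right (Finset.subset_insert _ _) hd12
        have hQc := Finset.card_sdiff_of_subset hX3
        obtain ⟨W0, hW0, hW0c, -, hRW⟩ := RoundTo.exists_three hT ∅ (X \ X3)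
          (H \ H1) (by simp) (by simp)
          (Finset.disjoint_of_subset_left Finset.sdiff_subset
            (Finset.disjoint_of_subset_right Finset.sdiff_subset hHX.symm))
          (2 ^ (k + 1) - 1 - A1.card - A3.card) (by simp; omega)
        rw [Finset.empty_union] at hW0
        have hR1 := RoundTo.pair hT (hA a haA)
        have hRA1 := hM1.round hT (Finset.disjoint_of_subset_left hA1
            (Finset.disjoint_of_subset_right hH1 hAH))
        have hRA2 := hM3.round hT (Finset.disjoint_of_subset_left hA3
            (Finset.disjoint_of_subset_right hX3 hAX))
        have hsubW := hW0.sub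
        have hRound : RoundTo beats S (insert K (A1 ∪ A3 ∪ W0)) := by
          have := ((hR1.union hRA1 ?_).union hRA2 ?_).union hW0 ?_
          · convert this using 1
            · rw [hS, ← hAeq]
              ext x
              have e3 := @hH1 x
              have e4 := @hX3 x
              simp only [Finset.mem_insert, Finset.mem_union, Finset.mem_singleton,
                Finset.mem_sdiff]
              grind
            · ext x
              simp only [Finset.mem_insert, Finset.mem_union, Finset.mem_singleton]
              clear * -
              tauto
          all_goals
            rw [Finset.disjoint_left]
            intro x
            have e1 := @hA1 x
            have e2 := @hA3 x
            have e3 := @hH1 x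
            have e4 := @hX3 x
            have e5 := @dAH x
            have e6 := @dAX x
            have e7 := @dHX x
            have e8 := fun h => (Finset.disjoint_left.1 hd13) (show x ∈ A1 from h)
            simp only [Finset.mem_insert, Finset.mem_union, Finset.mem_singleton,
                Finset.mem_sdiff]
            grind
        have hA'sub : A1 ∪ A3 ⊆ A := Finset.union_subset hA1 hA3
        have hA'c : (A1 ∪ A3).card = A1.card + A3.card := Finset.card_union_of_disjoint hd13
        have inH : ∀ h ∈ H \ H1, ∀ a ∈ A, beats a h → a ∈ A1 := by
          intro h hh a ha hab
          rw [Finset.mem_sdiff] at hh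
          by_contra hn
          exact hmax1 a ha hn h hh.1 hh.2 hab
        have hWeq : insert K (A1 ∪ A3 ∪ W0) =
            insert K ((A1 ∪ A3) ∪ ((H \ H1) ∩ W0) ∪ ((X \ X3) ∩ W0)) := by
          ext x
          have := @hsubW x
          simp only [Finset.mem_insert, Finset.mem_union, Finset.mem_inter] at this ⊢
          clear * - this
          tauto
        have hWS := hRound.sub
        have hWcard : (insert K (A1 ∪ A3 ∪ W0)).card = 2 ^ (k + 1) := by
          rw [Finset.card_insert_of_notMem, Finset.card_union_of_disjoint, hA'c, hW0c]
          · omega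
          · rw [Finset.disjoint_left]
            intro x hx hx'
            have := hsubW hx'
            have e0 := hA'sub hx
            have e5 := @dAH x
            have e6 := @dAX x
            simp only [Finset.mem_union, Finset.mem_sdiff] at this hx
            clear * - this hx e0 e5 e6
            tauto
          · intro hK
            simp only [Finset.mem_union] at hK
            rcases hK with (h | h) | h
            · exact hKA (hA1 h)
            · exact hKA (hA3 h)
            · have := hsubW h
              simp only [Finset.mem_union, Finset.mem_sdiff] at this
              clear * - this hKA hKH hKX
              tauto
        have hlose := fun w hw => hRound.loser hT (w := w) hw
        obtain ⟨f, hf, hWf⟩ := hRound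
        refine SEWinner.round S _ f K hf hWf ?_
        refine ih _ (A1 ∪ A3) ((H \ H1) ∩ W0) ((X \ X3) ∩ W0) hWcard hWeq
          ?_ ?_ ?_ ?_ ?_ ?_ ?_ ?_ ?_ ?_
        · refine Finset.disjoint_of_subset_left hA'sub (Finset.disjoint_of_subset_right ?_ hAH)
          exact Finset.inter_subset_left.trans Finset.sdiff_subset
        · refine Finset.disjoint_of_subset_left hA'sub (Finset.disjoint_of_subset_right ?_ hAX)
          exact Finset.inter_subset_left.trans Finset.sdiff_subset
        · refine Finset.disjoint_of_subset_left ?_ (Finset.disjoint_of_subset_right ?_ hHX)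
          · exact Finset.inter_subset_left.trans Finset.sdiff_subset
          · exact Finset.inter_subset_left.trans Finset.sdiff_subset
        · exact fun a ha => hA a (hA'sub ha)
        · exact fun h hh => hH h (Finset.mem_sdiff.1 (Finset.mem_inter.1 hh).1).1
        · exact fun h hh => hX h (Finset.mem_sdiff.1 (Finset.mem_inter.1 hh).1).1
        · intro h hh
          have hh := (Finset.mem_inter.1 hh).1
          obtain ⟨a, ha, hab⟩ := hkH h (Finset.mem_sdiff.1 hh).1
          exact ⟨a, by simp [inH h hh a ha hab], hab⟩
        · intro x hx
          rw [Finset.mem_inter] at hx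
          by_contra hcon
          push Not at hcon
          obtain ⟨y, hy, -, hxy⟩ := hW0.loser hT hx.2
          refine weak x (Finset.mem_sdiff.1 hx.1).1 a ?_ y ?_ hxy
          · intro c hcA hcx
            by_contra hne
            refine hcon c ?_ hcx
            rw [hA13]
            exact Finset.mem_erase.2 ⟨hne, hcA⟩
          · simp only [Finset.mem_union, Finset.mem_sdiff] at hy
            clear * - hy
            tauto
        · rw [hA'c]
          by_cases hH0 : H.card = 0
          · by_cases hAone : A.card = 1
            · obtain ⟨a', ha'⟩ := Finset.card_eq_one.1 hAone
              have := weak1 a' (by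
                intro j hj c hcA _
                simpa [ha'] using hcA)
              omega
            · omega
          · have hp := hHpos (Nat.pos_of_ne_zero hH0)
            omega
        · intro x hx
          have hxW0 := (Finset.mem_inter.1 hx).2
          have hxQ := (Finset.mem_inter.1 hx).1
          have hxX := (Finset.mem_sdiff.1 hxQ).1
          rcases hI x hxX with h | h
          · left
            rw [hA13, Finset.filter_erase]
            have := Finset.pred_card_le_card_erase (s := A.filter (fun a => beats a x)) (a := a)
            omega
          · right
            obtain ⟨y, hyS, hyW, hxy⟩ := hlose x (by simp [hxW0])
            have hsub : insert y ((insert K (A1 ∪ A3 ∪ W0)).filter (beats x)) ⊆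
                S.filter (beats x) := by
              intro z hz
              rw [Finset.mem_insert, Finset.mem_filter] at hz
              rw [Finset.mem_filter]
              rcases hz with rfl | hz
              · exact ⟨hyS, hxy⟩
              · exact ⟨hWS hz.1, hz.2⟩
            have h4 := Finset.card_le_card hsub
            rw [Finset.card_insert_of_notMem (fun h => hyW (Finset.mem_filter.1 h).1)] at h4
            omega

end helpers

/-- generalized structural result for kings (Theorem 1 of the paper). -/
theorem king_partition_SE_winner {V : Type*} [Fintype V]
    (beats : V → V → Prop) (hT : IsTournament beats)
    (k : ℕ) (hcard : Fintype.card V = 2 ^ k)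
    (K : V) (hking : IsKing beats K)
    (H I J : Set V)
    (hHI : Disjoint H I) (hHJ : Disjoint H J) (hIJ : Disjoint I J)
    (hcover : H ∪ I ∪ J = {u | beats u K})
    (h1 : H.ncard < {u | beats K u}.ncard)
    (h2 : ∀ i ∈ I, k ≤ {a | beats K a ∧ beats a i}.ncard)
    (h3 : ∀ j ∈ J, outDeg beats j ≤ {u | beats K u}.ncard) :
    SEWinner beats Finset.univ K := by
  classical
  have hn1 : ∀ p : V → Prop, {u | p u}.ncard = (Finset.univ.filter p).card := by
    intro p
    rw [← Set.ncard_coe_finset]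
    simp
  have hmem : ∀ u, (u ∈ H ∨ u ∈ I) ∨ u ∈ J ↔ beats u K := by
    intro u
    have := Set.ext_iff.1 hcover u
    simpa using this
  cases k with
  | zero =>
    exfalso
    have hle : {u | beats K u}.ncard ≠ 0 := by omega
    obtain ⟨u, hu⟩ := Set.nonempty_of_ncard_ne_zero hle
    have : u = K := Fintype.card_le_one_iff.1 (by rw [hcard]; norm_num) u K
    subst this
    exact hT.irrefl _ hu
  | succ k =>
    have hHn : H.ncard = (Finset.univ.filter (· ∈ H)).card := by
      rw [← hn1]; rfl
    have hkg : ∀ u, beats u K → ∃ a, beats K a ∧ beats a u := by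
      intro u hu
      have hne : u ≠ K := by
        rintro rfl
        exact hT.irrefl _ hu
      rcases hking u hne with h | h
      · exact absurd h (hT.asymm _ _ hu)
      · exact h
    rw [Set.disjoint_left] at hHI hHJ
    refine king_main hT K k Finset.univ (Finset.univ.filter (beats K))
      (Finset.univ.filter (· ∈ H)) (Finset.univ.filter (fun x => x ∈ I ∨ x ∈ J))
      (by rw [Finset.card_univ, hcard]) ?_ ?_ ?_ ?_ ?_ ?_ ?_ ?_ ?_ ?_ ?_
    · ext x
      have h1 := hmem x
      have h2 := hT.total x K
      simp only [Finset.mem_univ, Finset.mem_insert, Finset.mem_union, Finset.mem_filter, true_and,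
        true_iff]
      tauto
    · rw [Finset.disjoint_left]
      intro x hx hx'
      simp only [Finset.mem_filter, Finset.mem_univ, true_and] at hx hx'
      exact hT.asymm _ _ hx ((hmem x).1 (by tauto))
    · rw [Finset.disjoint_left]
      intro x hx hx'
      simp only [Finset.mem_filter, Finset.mem_univ, true_and] at hx hx'
      exact hT.asymm _ _ hx ((hmem x).1 (by tauto))
    · rw [Finset.disjoint_left]
      intro x hx hx'
      simp only [Finset.mem_filter, Finset.mem_univ, true_and] at hx hx'
      rcases hx' with h | h
      · exact hHI hx h
      · exact hHJ hx h
    · intro a ha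
      simpa using ha
    · intro x hx
      simp only [Finset.mem_filter, Finset.mem_univ, true_and] at hx
      exact (hmem x).1 (by tauto)
    · intro x hx
      simp only [Finset.mem_filter, Finset.mem_univ, true_and] at hx
      exact (hmem x).1 (by tauto)
    · intro x hx
      simp only [Finset.mem_filter, Finset.mem_univ, true_and] at hx ⊢
      exact hkg x ((hmem x).1 (by tauto))
    · intro x hx
      simp only [Finset.mem_filter, Finset.mem_univ, true_and] at hx ⊢
      exact hkg x ((hmem x).1 (by tauto))
    · rw [← hHn, ← hn1]
      exact h1
    · intro x hx
      simp only [Finset.mem_filter, Finset.mem_univ, true_and] at hx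
      rcases hx with h | h
      · left
        have := h2 x h
        rw [hn1] at this
        rw [Finset.filter_filter]
        convert this
      · right
        have := h3 x h
        unfold outDeg at this
        rw [hn1, hn1] at this
        exact this
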